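/- arXiv:2402.02291 — 2 statements merged into one kernel-verified Lean document; each statement's English description precedes it below -/
import Mathlib

section
/- Let K₁ be a bounded operator on H, let K₂ be a bounded operator on a complex Hilbert space H₂, and let Θ₁, Θ₂ : H → H₂ be bounded operators such that Θ₁ has closed range, Θ₁K₁ = K₂Θ₁, and ran(K₂*) ⊆ ran(Θ₁). Let {Υ_ξ}_{ξ∈Ω} be a continuous K₁-g-frame for H and {Φ_ξ}_{ξ∈Ω} a continuous g-Bessel family for H (both with values in E), and assume that for every g ∈ H₂: 2·Re ∫_Ω ⟨Υ_ξ Θ₁* g, Φ_ξ Θ₂* g⟩ dν(ξ) + ∫_Ω ‖Φ_ξ Θ₂* g‖² dν(ξ) ≥ 0. Then {Υ_ξ Θ₁* + Φ_ξ Θ₂*}_{ξ∈Ω} is a continuous K₂-g-frame for H₂. -/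
open MeasureTheory ContinuousLinearMap

noncomputable section

/-- `Υ` is a continuous g-Bessel family with bound `B`. -/
def IsCgBessel {Ω H E : Type*} [MeasurableSpace Ω]
    [NormedAddCommGroup H] [InnerProductSpace ℂ H]
    [NormedAddCommGroup E] [InnerProductSpace ℂ E]
    (ν : Measure Ω) (Υ : Ω → H →L[ℂ] E) (B : ℝ) : Prop :=
  0 < B ∧ ∀ h : H, Integrable (fun ξ => ‖Υ ξ h‖ ^ 2) ν ∧
    ∫ ξ, ‖Υ ξ h‖ ^ 2 ∂ν ≤ B * ‖h‖ ^ 2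

/-- `Υ` is a continuous `K`-g-frame with bounds `A ≤ B`. -/
def IsCKgFrame {Ω H E : Type*} [MeasurableSpace Ω]
    [NormedAddCommGroup H] [InnerProductSpace ℂ H] [CompleteSpace H]
    [NormedAddCommGroup E] [InnerProductSpace ℂ E]
    (ν : Measure Ω) (K : H →L[ℂ] H) (Υ : Ω → H →L[ℂ] E) (A B : ℝ) : Prop :=
  0 < A ∧ A ≤ B ∧ ∀ h : H,
    Integrable (fun ξ => ‖Υ ξ h‖ ^ 2) ν ∧
    A * ‖adjoint K h‖ ^ 2 ≤ ∫ ξ, ‖Υ ξ h‖ ^ 2 ∂ν ∧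
    ∫ ξ, ‖Υ ξ h‖ ^ 2 ∂ν ≤ B * ‖h‖ ^ 2

/-- The adjoint of an operator with closed range is bounded below on that range. -/
theorem exists_norm_le_mul_norm_adjoint_of_isClosed_range {H H2 : Type*}
    [NormedAddCommGroup H] [InnerProductSpace ℂ H] [CompleteSpace H]
    [NormedAddCommGroup H2] [InnerProductSpace ℂ H2] [CompleteSpace H2]
    (T : H →L[ℂ] H2) (hT : IsClosed (Set.range ⇑T)) :
    ∃ C > 0, ∀ y ∈ Set.range ⇑T, ‖y‖ ≤ C * ‖adjoint T y‖ := by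
  have hT' : IsClosed (T.range : Set H2) := by
    rw [LinearMap.coe_range]; exact hT
  have : CompleteSpace T.range := hT'.completeSpace_coe
  obtain ⟨C, hC, h⟩ := exists_preimage_norm_le T.rangeRestrict
    (fun y => by obtain ⟨x, hx⟩ := y.2; exact ⟨x, Subtype.ext hx⟩)
  refine ⟨C, hC, fun y hy => ?_⟩
  obtain ⟨x, hx, hxn⟩ := h ⟨y, hy⟩
  have hx : T x = y := congrArg Subtype.val hx
  have hxn : ‖x‖ ≤ C * ‖y‖ := hxn
  have hsq : ‖y‖ ^ 2 ≤ ‖x‖ * ‖adjoint T y‖ := by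
    calc ‖y‖ ^ 2 = ‖(inner ℂ y y : ℂ)‖ := by
          rw [inner_self_eq_norm_sq_to_K]; simp
      _ = ‖(inner ℂ x (adjoint T y) : ℂ)‖ := by rw [adjoint_inner_right, hx]
      _ ≤ _ := norm_inner_le_norm _ _
  rcases (norm_nonneg y).eq_or_lt with h0 | h0
  · rw [← h0]; positivity
  · have := mul_le_mul_of_nonneg_right hxn (norm_nonneg (adjoint T y))
    refine le_of_mul_le_mul_left ?_ h0
    nlinarith

theorem norm_add_sq_le_two_mul {E : Type*} [SeminormedAddCommGroup E] (a b : E) :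
    ‖a + b‖ ^ 2 ≤ 2 * ‖a‖ ^ 2 + 2 * ‖b‖ ^ 2 := by
  nlinarith [norm_add_le a b, norm_nonneg (a + b), sq_nonneg (‖a‖ - ‖b‖)]

theorem integrable_norm_add_sq {Ω E : Type*} [MeasurableSpace Ω] [NormedAddCommGroup E]
    {ν : Measure Ω} {f g : Ω → E}
    (hf : AEStronglyMeasurable f ν) (hg : AEStronglyMeasurable g ν)
    (hfi : Integrable (fun ξ => ‖f ξ‖ ^ 2) ν) (hgi : Integrable (fun ξ => ‖g ξ‖ ^ 2) ν) :
    Integrable (fun ξ => ‖f ξ + g ξ‖ ^ 2) ν := by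
  refine ((hfi.const_mul 2).add (hgi.const_mul 2)).mono' ((hf.add hg).norm.pow 2)
    (.of_forall fun ξ => ?_)
  rw [Real.norm_of_nonneg (by positivity)]
  exact norm_add_sq_le_two_mul _ _

theorem integral_norm_add_sq_le {Ω E : Type*} [MeasurableSpace Ω] [NormedAddCommGroup E]
    {ν : Measure Ω} {f g : Ω → E}
    (hf : AEStronglyMeasurable f ν) (hg : AEStronglyMeasurable g ν)
    (hfi : Integrable (fun ξ => ‖f ξ‖ ^ 2) ν) (hgi : Integrable (fun ξ => ‖g ξ‖ ^ 2) ν) :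
    ∫ ξ, ‖f ξ + g ξ‖ ^ 2 ∂ν ≤ 2 * ∫ ξ, ‖f ξ‖ ^ 2 ∂ν + 2 * ∫ ξ, ‖g ξ‖ ^ 2 ∂ν := by
  rw [← integral_const_mul, ← integral_const_mul,
    ← integral_add (hfi.const_mul 2) (hgi.const_mul 2)]
  exact integral_mono (integrable_norm_add_sq hf hg hfi hgi)
    ((hfi.const_mul 2).add (hgi.const_mul 2)) fun ξ => norm_add_sq_le_two_mul _ _

section SquareIntegrable

variable {Ω E : Type*} [MeasurableSpace Ω] [NormedAddCommGroup E] [InnerProductSpace ℂ E]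
  {ν : Measure Ω} {f g : Ω → E}

theorem integrable_inner_of_integrable_norm_sq
    (hf : AEStronglyMeasurable f ν) (hg : AEStronglyMeasurable g ν)
    (hfi : Integrable (fun ξ => ‖f ξ‖ ^ 2) ν) (hgi : Integrable (fun ξ => ‖g ξ‖ ^ 2) ν) :
    Integrable (fun ξ => (inner ℂ (f ξ) (g ξ) : ℂ)) ν := by
  refine (hfi.add hgi).mono' (hf.inner hg) (.of_forall fun ξ => ?_)
  have := norm_inner_le_norm (𝕜 := ℂ) (f ξ) (g ξ)
  simp only [Pi.add_apply]
  nlinarith [sq_nonneg (‖f ξ‖ - ‖g ξ‖), sq_nonneg ‖f ξ‖, sq_nonneg ‖g ξ‖]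

theorem integral_norm_add_sq
    (hf : AEStronglyMeasurable f ν) (hg : AEStronglyMeasurable g ν)
    (hfi : Integrable (fun ξ => ‖f ξ‖ ^ 2) ν) (hgi : Integrable (fun ξ => ‖g ξ‖ ^ 2) ν) :
    ∫ ξ, ‖f ξ + g ξ‖ ^ 2 ∂ν = ∫ ξ, ‖f ξ‖ ^ 2 ∂ν +
      (2 * (∫ ξ, (inner ℂ (f ξ) (g ξ) : ℂ) ∂ν).re + ∫ ξ, ‖g ξ‖ ^ 2 ∂ν) := by
  have hi := integrable_inner_of_integrable_norm_sq hf hg hfi hgi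
  have hre : Integrable (fun ξ => 2 * (inner ℂ (f ξ) (g ξ) : ℂ).re) ν := hi.re.const_mul 2
  have hint : ∫ ξ, (inner ℂ (f ξ) (g ξ) : ℂ).re ∂ν = (∫ ξ, (inner ℂ (f ξ) (g ξ) : ℂ) ∂ν).re :=
    integral_re hi
  have hpt : ∀ ξ, ‖f ξ + g ξ‖ ^ 2 =
      ‖f ξ‖ ^ 2 + 2 * (inner ℂ (f ξ) (g ξ) : ℂ).re + ‖g ξ‖ ^ 2 := fun ξ =>
    norm_add_sq (𝕜 := ℂ) (f ξ) (g ξ)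
  simp_rw [hpt]
  rw [integral_add (by exact hfi.add hre) hgi, integral_add hfi hre, integral_const_mul, hint]
  ring

end SquareIntegrable

theorem stmt13 {Ω H H2 E : Type*} [MeasurableSpace Ω]
    [NormedAddCommGroup H] [InnerProductSpace ℂ H] [CompleteSpace H]
    [NormedAddCommGroup H2] [InnerProductSpace ℂ H2] [CompleteSpace H2]
    [NormedAddCommGroup E] [InnerProductSpace ℂ E]
    (ν : Measure Ω) (K1 : H →L[ℂ] H) (K2 : H2 →L[ℂ] H2)
    (Θ1 Θ2 : H →L[ℂ] H2) (Υ Φ : Ω → H →L[ℂ] E)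
    (hmeasΥ : ∀ h : H, AEStronglyMeasurable (fun ξ => Υ ξ h) ν)
    (hmeasΦ : ∀ h : H, AEStronglyMeasurable (fun ξ => Φ ξ h) ν)
    (hclosed : IsClosed (Set.range ⇑Θ1))
    (hcomm : Θ1 ∘L K1 = K2 ∘L Θ1)
    (hran : Set.range ⇑(adjoint K2) ⊆ Set.range ⇑Θ1)
    (hΥ : ∃ A B : ℝ, IsCKgFrame ν K1 Υ A B)
    (hΦ : ∃ B : ℝ, IsCgBessel ν Φ B)
    (hpos : ∀ g : H2,
      0 ≤ 2 * (∫ ξ, (inner ℂ (Υ ξ (adjoint Θ1 g)) (Φ ξ (adjoint Θ2 g)) : ℂ) ∂ν).re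
          + ∫ ξ, ‖Φ ξ (adjoint Θ2 g)‖ ^ 2 ∂ν) :
    ∃ A B : ℝ, IsCKgFrame ν K2
      (fun ξ => (Υ ξ).comp (adjoint Θ1) + (Φ ξ).comp (adjoint Θ2)) A B := by
  obtain ⟨A, B, hA, hAB, hΥ⟩ := hΥ
  obtain ⟨D, hD, hΦ⟩ := hΦ
  obtain ⟨C, hC, hlow⟩ := exists_norm_le_mul_norm_adjoint_of_isClosed_range Θ1 hclosed
  have hB : 0 < B := hA.trans_le hAB
  have hadj : ∀ g : H2, adjoint K1 (adjoint Θ1 g) = adjoint Θ1 (adjoint K2 g) := fun g => by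
    have := congrArg adjoint hcomm
    rw [adjoint_comp, adjoint_comp] at this
    exact DFunLike.congr_fun this g
  refine ⟨A / C ^ 2, max (A / C ^ 2) (2 * B * ‖adjoint Θ1‖ ^ 2 + 2 * D * ‖adjoint Θ2‖ ^ 2),
    by positivity, le_max_left _ _, fun g => ?_⟩
  obtain ⟨hfi, hfA, hfB⟩ := hΥ (adjoint Θ1 g)
  obtain ⟨hgi, hgD⟩ := hΦ (adjoint Θ2 g)
  have hf := hmeasΥ (adjoint Θ1 g)
  have hg := hmeasΦ (adjoint Θ2 g)
  simp only [add_apply, comp_apply]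
  refine ⟨integrable_norm_add_sq hf hg hfi hgi, ?_, ?_⟩
  · rw [integral_norm_add_sq hf hg hfi hgi]
    have hK : ‖adjoint K2 g‖ ^ 2 ≤ C ^ 2 * ‖adjoint K1 (adjoint Θ1 g)‖ ^ 2 := by
      rw [hadj, ← mul_pow]
      exact pow_le_pow_left₀ (norm_nonneg _) (hlow _ (hran ⟨g, rfl⟩)) 2
    calc A / C ^ 2 * ‖adjoint K2 g‖ ^ 2
        ≤ A / C ^ 2 * (C ^ 2 * ‖adjoint K1 (adjoint Θ1 g)‖ ^ 2) := by gcongr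
      _ = A * ‖adjoint K1 (adjoint Θ1 g)‖ ^ 2 := by field_simp
      _ ≤ _ := by linarith [hpos g]
  · calc _ ≤ 2 * ∫ ξ, ‖Υ ξ (adjoint Θ1 g)‖ ^ 2 ∂ν + 2 * ∫ ξ, ‖Φ ξ (adjoint Θ2 g)‖ ^ 2 ∂ν :=
          integral_norm_add_sq_le hf hg hfi hgi
      _ ≤ 2 * (B * (‖adjoint Θ1‖ * ‖g‖) ^ 2) + 2 * (D * (‖adjoint Θ2‖ * ‖g‖) ^ 2) := by
          gcongr
          · exact hfB.trans (by gcongr; exact le_opNorm _ _)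
          · exact hgD.trans (by gcongr; exact le_opNorm _ _)
      _ = (2 * B * ‖adjoint Θ1‖ ^ 2 + 2 * D * ‖adjoint Θ2‖ ^ 2) * ‖g‖ ^ 2 := by ring
      _ ≤ _ := by gcongr; exact le_max_right _ _
end
end

section
/- Let K₁ be a bounded operator on H with closed range, let K₂ be a bounded operator on a complex Hilbert space H₂, let Θ₁, Θ₂ : H → H₂ be bounded operators, and let α₁, α₂ > 0. Let {Υ_ξ}_{ξ∈Ω} and {Φ_ξ}_{ξ∈Ω} be continuous K₁-g-frames for H (values in E) such that for every g ∈ H₂: Re ∫_Ω ⟨Υ_ξ Θ₁* g, Φ_ξ Θ₂* g⟩ dν(ξ) ≥ 0. Set Q = α₁Θ₁ − α₂Θ₂ and assume ran(K₂) ⊆ ran(Q) and ran(Q*) ⊆ ran(K₁). Then {α₁ Υ_ξ Θ₁* + α₂ Φ_ξ Θ₂*}_{ξ∈Ω} is a continuous K₂-g-frame for H₂. -/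
open MeasureTheory ContinuousLinearMap

noncomputable section

/-- The majorization half of Douglas' lemma: if `ran S ⊆ ran T`, then `‖S† g‖ ≤ C ‖T† g‖`. -/
theorem exists_norm_adjoint_le_of_range_subset {F G H : Type*}
    [NormedAddCommGroup F] [InnerProductSpace ℂ F] [CompleteSpace F]
    [NormedAddCommGroup G] [InnerProductSpace ℂ G] [CompleteSpace G]
    [NormedAddCommGroup H] [InnerProductSpace ℂ H] [CompleteSpace H]
    (S : F →L[ℂ] G) (T : H →L[ℂ] G) (hST : Set.range ⇑S ⊆ Set.range ⇑T) :
    ∃ C : ℝ, 0 < C ∧ ∀ g : G, ‖adjoint S g‖ ≤ C * ‖adjoint T g‖ := by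
  have key : ∀ x : F, ∃ y : H, ∀ g : G, inner ℂ (adjoint S g) x = inner ℂ (adjoint T g) y := by
    intro x
    obtain ⟨y, hy⟩ := hST ⟨x, rfl⟩
    exact ⟨y, fun g => by rw [adjoint_inner_left, adjoint_inner_left, hy]⟩
  obtain ⟨C, hC⟩ := banach_steinhaus
    (g := fun g : G => ((‖adjoint T g‖⁻¹ : ℝ) : ℂ) • innerSL ℂ (adjoint S g)) (by
      intro x
      obtain ⟨y, hy⟩ := key x
      refine ⟨‖y‖, fun g => ?_⟩
      rw [smul_apply, innerSL_apply_apply, hy, norm_smul, Complex.norm_real, norm_inv, norm_norm]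
      refine (mul_le_mul_of_nonneg_left (norm_inner_le_norm _ _) (by positivity)).trans ?_
      rw [← mul_assoc]
      exact mul_le_of_le_one_left (norm_nonneg _) (inv_mul_le_one))
  refine ⟨max C 1, by positivity, fun g => ?_⟩
  rcases eq_or_ne (adjoint T g) 0 with h0 | h0
  · obtain ⟨y, hy⟩ := key (adjoint S g)
    have h := hy g
    rw [h0, inner_zero_left, inner_self_eq_zero] at h
    simp [h, h0]
  · have h := hC g
    have hp : 0 < ‖adjoint T g‖ := norm_pos_iff.mpr h0
    rw [norm_smul, innerSL_apply_norm, Complex.norm_real, norm_inv, norm_norm,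
      inv_mul_le_iff₀ hp, mul_comm] at h
    exact h.trans (mul_le_mul_of_nonneg_right (le_max_left _ _) hp.le)

/-- The adjoint of an operator with closed range is bounded below on that range. -/
theorem exists_norm_le_norm_adjoint_of_isClosed_range {F G : Type*}
    [NormedAddCommGroup F] [InnerProductSpace ℂ F] [CompleteSpace F]
    [NormedAddCommGroup G] [InnerProductSpace ℂ G] [CompleteSpace G]
    (T : F →L[ℂ] G) (hT : IsClosed (Set.range ⇑T)) :
    ∃ C : ℝ, 0 < C ∧ ∀ y ∈ Set.range ⇑T, ‖y‖ ≤ C * ‖adjoint T y‖ := by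
  have hc : IsClosed ((LinearMap.range T.toLinearMap : Submodule ℂ G) : Set G) := by
    exact hT
  have : CompleteSpace (LinearMap.range T.toLinearMap) := hc.completeSpace_coe
  obtain ⟨C, hC, h⟩ := (T.codRestrict (LinearMap.range T.toLinearMap)
    (fun x => ⟨x, rfl⟩)).exists_preimage_norm_le (by
      rintro ⟨_, x, rfl⟩
      exact ⟨x, rfl⟩)
  refine ⟨C, hC, fun y hy => ?_⟩
  obtain ⟨x, hx, hxn⟩ := h ⟨y, hy⟩
  have hxy : T x = y := congrArg Subtype.val hx
  replace hxn : ‖x‖ ≤ C * ‖y‖ := hxn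
  have h1 : ‖y‖ * ‖y‖ ≤ ‖adjoint T y‖ * ‖x‖ := by
    have h2 : inner ℂ (adjoint T y) x = inner ℂ y y := by rw [adjoint_inner_left, hxy]
    have h3 := norm_inner_le_norm (𝕜 := ℂ) (adjoint T y) x
    rwa [h2, ← inner_self_re_eq_norm, inner_self_eq_norm_mul_norm] at h3
  rcases (norm_nonneg y).eq_or_lt with h0 | h0
  · rw [← h0]; positivity
  · refine le_of_mul_le_mul_right (h1.trans ?_) h0
    calc ‖adjoint T y‖ * ‖x‖ ≤ ‖adjoint T y‖ * (C * ‖y‖) := by gcongr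
      _ = C * ‖adjoint T y‖ * ‖y‖ := by ring

/-- Expansion of `∫ ‖a u + b v‖²` for real coefficients and square-integrable `u`, `v`. -/
theorem integral_norm_smul_add_smul_sq {Ω E : Type*} [MeasurableSpace Ω]
    [NormedAddCommGroup E] [InnerProductSpace ℂ E] {ν : Measure Ω} {u v : Ω → E}
    (hu : MemLp u 2 ν) (hv : MemLp v 2 ν) (a b : ℝ) :
    ∫ ξ, ‖(a : ℂ) • u ξ + (b : ℂ) • v ξ‖ ^ 2 ∂ν =
      a ^ 2 * ∫ ξ, ‖u ξ‖ ^ 2 ∂ν + 2 * a * b * (∫ ξ, (inner ℂ (u ξ) (v ξ) : ℂ) ∂ν).re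
        + b ^ 2 * ∫ ξ, ‖v ξ‖ ^ 2 ∂ν := by
  have hu2 := hu.norm.integrable_sq
  have hv2 := hv.norm.integrable_sq
  have huv : Integrable (fun ξ => (inner ℂ (u ξ) (v ξ) : ℂ)) ν := by
    refine (hu2.add hv2).mono' (hu.1.inner hv.1) (.of_forall fun ξ => ?_)
    have := norm_inner_le_norm (𝕜 := ℂ) (u ξ) (v ξ)
    simp only [Pi.add_apply]
    nlinarith [sq_nonneg (‖u ξ‖ - ‖v ξ‖), sq_nonneg (‖u ξ‖ + ‖v ξ‖)]
  have hre : (∫ ξ, (inner ℂ (u ξ) (v ξ) : ℂ) ∂ν).re = ∫ ξ, (inner ℂ (u ξ) (v ξ) : ℂ).re ∂ν :=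
    (integral_re huv).symm
  have hur : Integrable (fun ξ => (inner ℂ (u ξ) (v ξ) : ℂ).re) ν := huv.re
  rw [hre, ← integral_const_mul, ← integral_const_mul, ← integral_const_mul,
    ← integral_add (hu2.const_mul _) (hur.const_mul _),
    ← integral_add (by fun_prop) (by fun_prop)]
  refine integral_congr_ae (.of_forall fun ξ => ?_)
  have h := norm_add_sq (𝕜 := ℂ) ((a : ℂ) • u ξ) ((b : ℂ) • v ξ)
  simp only [h, norm_smul, inner_smul_left, inner_smul_right, Complex.norm_real, mul_pow,
    Real.norm_eq_abs, sq_abs, Complex.conj_ofReal, RCLike.re_to_complex, Complex.re_ofReal_mul]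
  ring

theorem stmt15 {Ω H H2 E : Type*} [MeasurableSpace Ω]
    [NormedAddCommGroup H] [InnerProductSpace ℂ H] [CompleteSpace H]
    [NormedAddCommGroup H2] [InnerProductSpace ℂ H2] [CompleteSpace H2]
    [NormedAddCommGroup E] [InnerProductSpace ℂ E]
    (ν : Measure Ω) (K1 : H →L[ℂ] H) (K2 : H2 →L[ℂ] H2)
    (Θ1 Θ2 : H →L[ℂ] H2) (Υ Φ : Ω → H →L[ℂ] E) (α1 α2 : ℝ)
    (hα1 : 0 < α1) (hα2 : 0 < α2)
    (hmeasΥ : ∀ h : H, AEStronglyMeasurable (fun ξ => Υ ξ h) ν)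
    (hmeasΦ : ∀ h : H, AEStronglyMeasurable (fun ξ => Φ ξ h) ν)
    (hK1closed : IsClosed (Set.range ⇑K1))
    (hΥ : ∃ A B : ℝ, IsCKgFrame ν K1 Υ A B)
    (hΦ : ∃ A B : ℝ, IsCKgFrame ν K1 Φ A B)
    (hpos : ∀ g : H2,
      0 ≤ (∫ ξ, (inner ℂ (Υ ξ (adjoint Θ1 g)) (Φ ξ (adjoint Θ2 g)) : ℂ) ∂ν).re)
    (hranK2 : Set.range ⇑K2 ⊆ Set.range ⇑((α1 : ℂ) • Θ1 - (α2 : ℂ) • Θ2))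
    (hranP : Set.range ⇑(adjoint ((α1 : ℂ) • Θ1 - (α2 : ℂ) • Θ2)) ⊆ Set.range ⇑K1) :
    ∃ A B : ℝ, IsCKgFrame ν K2
      (fun ξ => (α1 : ℂ) • (Υ ξ).comp (adjoint Θ1)
        + (α2 : ℂ) • (Φ ξ).comp (adjoint Θ2)) A B := by
  obtain ⟨A1, B1, hA1, hAB1, h1⟩ := hΥ
  obtain ⟨A2, B2, hA2, hAB2, h2⟩ := hΦ
  obtain ⟨C, hC, hdouglas⟩ := exists_norm_adjoint_le_of_range_subset _ _ hranK2
  obtain ⟨D, hD, hbelow⟩ := exists_norm_le_norm_adjoint_of_isClosed_range K1 hK1closed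
  set Q := (α1 : ℂ) • Θ1 - (α2 : ℂ) • Θ2 with hQ
  have hQadj : ∀ g, adjoint Q g = (α1 : ℂ) • adjoint Θ1 g - (α2 : ℂ) • adjoint Θ2 g := by
    intro g
    rw [hQ, map_sub, map_smulₛₗ, map_smulₛₗ]
    simp only [sub_apply, smul_apply, Complex.conj_ofReal]
  have hm : 0 < min A1 A2 := lt_min hA1 hA2
  set A := min A1 A2 / (2 * (C * D) ^ 2) with hA
  set B := 2 * (α1 ^ 2 * (B1 * ‖adjoint Θ1‖ ^ 2) + α2 ^ 2 * (B2 * ‖adjoint Θ2‖ ^ 2)) with hB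
  refine ⟨A, max A B, by positivity, le_max_left _ _, fun g => ?_⟩
  have hu : MemLp (fun ξ => Υ ξ (adjoint Θ1 g)) 2 ν :=
    (memLp_two_iff_integrable_sq_norm (hmeasΥ _)).2 (h1 _).1
  have hv : MemLp (fun ξ => Φ ξ (adjoint Θ2 g)) 2 ν :=
    (memLp_two_iff_integrable_sq_norm (hmeasΦ _)).2 (h2 _).1
  have hint : MemLp (fun ξ => (α1 : ℂ) • Υ ξ (adjoint Θ1 g) + (α2 : ℂ) • Φ ξ (adjoint Θ2 g)) 2 ν :=
    (hu.const_smul _).add (hv.const_smul _)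
  have hexp := integral_norm_smul_add_smul_sq hu hv α1 α2
  obtain ⟨-, hl1, hr1⟩ := h1 (adjoint Θ1 g)
  obtain ⟨-, hl2, hr2⟩ := h2 (adjoint Θ2 g)
  simp only [add_apply, smul_apply, comp_apply]
  refine ⟨hint.norm.integrable_sq, ?_, ?_⟩
  · have hchain : ‖adjoint K2 g‖ ≤ C * D * ‖adjoint K1 (adjoint Q g)‖ :=
      (hdouglas g).trans (by
        rw [mul_assoc]
        exact mul_le_mul_of_nonneg_left (hbelow _ (hranP ⟨g, rfl⟩)) hC.le)
    have htri : ‖adjoint K1 (adjoint Q g)‖ ≤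
        α1 * ‖adjoint K1 (adjoint Θ1 g)‖ + α2 * ‖adjoint K1 (adjoint Θ2 g)‖ := by
      rw [hQadj, map_sub, map_smul, map_smul]
      refine (norm_sub_le _ _).trans_eq ?_
      simp [norm_smul, abs_of_pos hα1, abs_of_pos hα2]
    set p := ‖adjoint K1 (adjoint Θ1 g)‖
    set q := ‖adjoint K1 (adjoint Θ2 g)‖
    have hre : 0 ≤ 2 * α1 * α2 *
        (∫ ξ, (inner ℂ (Υ ξ (adjoint Θ1 g)) (Φ ξ (adjoint Θ2 g)) : ℂ) ∂ν).re :=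
      mul_nonneg (by positivity) (hpos g)
    calc A * ‖adjoint K2 g‖ ^ 2
        ≤ A * (C * D * (α1 * p + α2 * q)) ^ 2 := by
          gcongr
          exact hchain.trans (by gcongr)
      _ = min A1 A2 * ((α1 * p + α2 * q) ^ 2 / 2) := by
          rw [hA]; field_simp
      _ ≤ min A1 A2 * ((α1 * p) ^ 2 + (α2 * q) ^ 2) := by
          gcongr
          nlinarith [sq_nonneg (α1 * p - α2 * q)]
      _ = α1 ^ 2 * (min A1 A2 * p ^ 2) + α2 ^ 2 * (min A1 A2 * q ^ 2) := by ring
      _ ≤ α1 ^ 2 * (A1 * p ^ 2) + α2 ^ 2 * (A2 * q ^ 2) := by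
          gcongr
          · exact min_le_left _ _
          · exact min_le_right _ _
      _ ≤ α1 ^ 2 * (∫ ξ, ‖Υ ξ (adjoint Θ1 g)‖ ^ 2 ∂ν)
          + α2 ^ 2 * (∫ ξ, ‖Φ ξ (adjoint Θ2 g)‖ ^ 2 ∂ν) := by gcongr
      _ ≤ _ := by rw [hexp]; linarith
  · have hB1 : 0 ≤ B1 := hA1.le.trans hAB1
    have hB2 : 0 ≤ B2 := hA2.le.trans hAB2
    -- parallelogram law in `L²`
    have hexp' := integral_norm_smul_add_smul_sq hu hv α1 (-α2)
    have hnn : 0 ≤ ∫ ξ, ‖(α1 : ℂ) • Υ ξ (adjoint Θ1 g)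
        + ((-α2 : ℝ) : ℂ) • Φ ξ (adjoint Θ2 g)‖ ^ 2 ∂ν := integral_nonneg fun ξ => by positivity
    have hn1 := (adjoint Θ1).le_opNorm g
    have hn2 := (adjoint Θ2).le_opNorm g
    calc _ ≤ 2 * (α1 ^ 2 * (∫ ξ, ‖Υ ξ (adjoint Θ1 g)‖ ^ 2 ∂ν)
          + α2 ^ 2 * (∫ ξ, ‖Φ ξ (adjoint Θ2 g)‖ ^ 2 ∂ν)) := by
          rw [hexp]; rw [hexp'] at hnn; linarith
      _ ≤ 2 * (α1 ^ 2 * (B1 * ‖adjoint Θ1 g‖ ^ 2) + α2 ^ 2 * (B2 * ‖adjoint Θ2 g‖ ^ 2)) := by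
          gcongr
      _ ≤ 2 * (α1 ^ 2 * (B1 * (‖adjoint Θ1‖ * ‖g‖) ^ 2)
          + α2 ^ 2 * (B2 * (‖adjoint Θ2‖ * ‖g‖) ^ 2)) := by gcongr
      _ = B * ‖g‖ ^ 2 := by rw [hB]; ring
      _ ≤ max A B * ‖g‖ ^ 2 := by gcongr; exact le_max_right _ _
end
end
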